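/- arXiv:math/0211234 — 2 statements merged into one kernel-verified Lean document; each statement's English description precedes it below -/
import Mathlib

section
/- With τ₀ = 0.32, the following inequality holds: I(1.301·√(4π·0.64 − 0.64²)/0.64, 5, −1.301, 1) > 0, i.e., 1.301·circPerim0(2τ₀)/(2τ₀) + 1.301·B' − p₅ > 0. -/
open Real

/-- Perimeter of a regular spherical `n`-gon of area `x` on the unit sphere. -/
noncomputable def regPerim (x n : ℝ) : ℝ :=
  n * Real.arccos ((Real.cos (2 * π / n) +
      (Real.cos ((π - (2 * π - x) / n) / 2)) ^ 2) /
      (Real.sin ((π - (2 * π - x) / n) / 2)) ^ 2)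

/-- Circumference of a circle on the unit sphere enclosing area `a`. -/
noncomputable def circPerim0 (a : ℝ) : ℝ := Real.sqrt (4 * π * a - a ^ 2)

/-- Perimeter of the regular spherical pentagon of area `π/3`. -/
noncomputable def p5 : ℝ := 5 * Real.arccos ((4 * Real.cos (2 * π / 5) + 1) / 3)

/-- Derivative at `n = 5` of `n ↦ regPerim (π/3) n`. -/
noncomputable def p5' : ℝ := deriv (fun n : ℝ => regPerim (π / 3) n) 5

/-- `B' = -∂₁ regPerim (π/3, 5)`. -/
noncomputable def B' : ℝ := - deriv (fun x : ℝ => regPerim x 5) (π / 3)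

/-- The isoperimetric functional `I(ℓ, n, t, ρ)`. -/
noncomputable def Ifun (ℓ n t ρ : ℝ) : ℝ := ℓ - t * B' + (5 - n) * p5' - ρ * p5

theorem cos_two_pi_div_five : cos (2 * π / 5) = (√5 - 1) / 4 := by
  have h5 : √5 ^ 2 = 5 := sq_sqrt (by norm_num)
  rw [show 2 * π / 5 = 2 * (π / 5) by ring, cos_two_mul, cos_pi_div_five]
  nlinarith

theorem p5_eq : p5 = 5 * arccos (√5 / 3) := by
  rw [p5, cos_two_pi_div_five]
  ring_nf

theorem p5_le : p5 ≤ 5 * (π / 4 - 0.0556) := by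
  have hcos : cos (π / 4 - 0.0556) ≤ √5 / 3 := by
    have hc := (abs_le.1 (cos_bound (x := 0.0556) (by norm_num [abs_of_pos]))).2
    rw [abs_of_pos (by norm_num)] at hc
    have hs : sin 0.0556 ≤ 0.0556 := sin_le (by norm_num)
    have h2 : √2 ≤ 1.414214 := sqrt_le_iff.2 (by norm_num)
    have h5 : 2.236067 ≤ √5 := le_sqrt_of_sq_le (by norm_num)
    have hle : cos 0.0556 + sin 0.0556 ≤ 1.05407 := by norm_num at hc hs ⊢; linarith
    rw [cos_sub, cos_pi_div_four, sin_pi_div_four]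
    nlinarith [sqrt_nonneg 2]
  have hπ := pi_gt_three
  have h := arccos_le_arccos hcos
  rw [arccos_cos (by norm_num; linarith) (by norm_num; linarith)] at h
  rw [p5_eq]
  linarith

theorem hasDerivAt_regPerim_five :
    HasDerivAt (fun x : ℝ => regPerim x 5) ((3 + √5) / (2 * √3)) (π / 3) := by
  have h5 : √5 ^ 2 = 5 := sq_sqrt (by norm_num)
  have h3 : √3 ^ 2 = 3 := sq_sqrt (by norm_num)
  have h3pos : 0 < √3 := sqrt_pos.2 (by norm_num)
  have hsqrt5 : √5 < 3 := (sqrt_lt' (by norm_num)).2 (by norm_num)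
  have hsqrt5pos := sqrt_nonneg 5
  have hangle : (π - (2 * π - π / 3) / 5) / 2 = π / 3 := by ring
  have hθ : HasDerivAt (fun x : ℝ => (π - (2 * π - x) / 5) / 2) (1 / 10) (π / 3) := by
    have h := ((((hasDerivAt_id (π / 3)).const_sub (2 * π)).div_const 5).const_sub π).div_const 2
    exact h.congr_deriv (by norm_num)
  have hnum := (hθ.cos.pow 2).const_add (cos (2 * π / 5))
  have hden := hθ.sin.pow 2
  have hu := hnum.div hden (by simp [hangle, h3pos.ne'])
  have hval : (cos (2 * π / 5) + cos (π / 3) ^ 2) / sin (π / 3) ^ 2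
      = √5 / 3 := by
    rw [cos_two_pi_div_five, cos_pi_div_three, sin_pi_div_three, div_pow (√3), h3]
    ring
  have hsq : √(1 - (√5 / 3) ^ 2) = 2 / 3 := by
    rw [div_pow, h5, show (1 : ℝ) - 5 / 3 ^ 2 = (2 / 3) ^ 2 by norm_num]
    exact sqrt_sq (by norm_num)
  have harc := hasDerivAt_arccos (x := √5 / 3) (by linarith) (by linarith)
  rw [hsq] at harc
  have hcomp := (HasDerivAt.comp_of_eq (π / 3) harc hu
    (by simpa only [Pi.div_apply, Pi.pow_apply, hangle] using hval.symm)).const_mul 5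
  refine hcomp.congr_deriv ?_
  simp only [Pi.pow_apply, hangle, cos_two_pi_div_five, cos_pi_div_three,
    sin_pi_div_three]
  field_simp
  norm_num
  linear_combination (-40 * √3 * √5) * h3

theorem B'_eq : B' = -((3 + √5) / (2 * √3)) := by
  rw [B', hasDerivAt_regPerim_five.deriv]

theorem le_B' : -1.51153 ≤ B' := by
  have h3 : 1.73205 ≤ √3 := le_sqrt_of_sq_le (by norm_num)
  have h5 : √5 ≤ 2.236068 := sqrt_le_iff.2 (by norm_num)
  rw [B'_eq, neg_le_neg_iff, div_le_iff₀ (by linarith)]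
  linarith

theorem le_circPerim0 : 2.7627 ≤ circPerim0 0.64 := by
  refine le_sqrt_of_sq_le ?_
  have := pi_gt_d6
  norm_num at this ⊢
  linarith

theorem case_Tabs_large :
    Ifun (1.301 * circPerim0 0.64 / 0.64) 5 (-1.301) 1 > 0 := by
  have hπ := pi_lt_d6
  have hp := p5_le
  have hB := le_B'
  have hc := le_circPerim0
  unfold Ifun
  norm_num at hπ hp hB hc ⊢
  linarith
end

section
/- Define ρ₁(5) = 0.913, ρ₁(6) = 0.952, ρ₁(7) = 0.99, T₁(5) = 0.117, T₁(6) = 0.065, T₁(7) = 0.0134, and set R(5) = 0.9957, R(6) = R(7) = 1. For each n ∈ {5, 6, 7}, each ρ with ρ₁(n) ≤ ρ ≤ R(n), and each t with 0 ≤ t ≤ T₁(n), one has I(regPerim(ρπ/3 − t, n), n, t, ρ) > 0, i.e., regPerim(ρπ/3 − t, n) − t·B' + (5 − n)·p₅' − ρ·p₅ > 0. -/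
open Real

/-- The constant `ρ₁` of the proof (values specified only for `n = 5, 6, 7`). -/
noncomputable def rho1 : ℕ → ℝ
  | 5 => 0.913
  | 6 => 0.952
  | 7 => 0.99
  | _ => 1

/-- The constant `T₁` of the proof (values specified only for `n = 5, 6, 7`). -/
noncomputable def T1 : ℕ → ℝ
  | 5 => 0.117
  | 6 => 0.065
  | 7 => 0.0134
  | _ => 0

/-- The constant `T₀` of the proof (values specified only for `n = 5, 6, 7`). -/
noncomputable def T0 : ℕ → ℝ
  | 5 => -0.1382
  | 6 => -0.0711
  | 7 => -0.01362
  | _ => 0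

/-- The constant `ρ₂` of the proof (values specified only for `n = 5, 6, 7`). -/
noncomputable def rho2 : ℕ → ℝ
  | 5 => 0.913
  | 6 => 0.952
  | 7 => 0.99
  | _ => 1

/-- The upper bound `R(n)`: `0.9957` for `n = 5` and `1` otherwise. -/
noncomputable def Rbd : ℕ → ℝ
  | 5 => 0.9957
  | _ => 1

/-- The area lower bound `a(n) = min (3.75 / n², 0.1)`. -/
noncomputable def aFn (n : ℕ) : ℝ := min (3.75 / (n : ℝ) ^ 2) 0.1

/-! ### Taylor bounds for sine and cosine -/

theorem le_of_hasDerivAt_le {f g f' g' : ℝ → ℝ} (hf : ∀ x, HasDerivAt f (f' x) x)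
    (hg : ∀ x, HasDerivAt g (g' x) x) (h0 : f 0 = g 0) (h : ∀ x, 0 ≤ x → f' x ≤ g' x)
    {x : ℝ} (hx : 0 ≤ x) : f x ≤ g x := by
  have hmono : MonotoneOn (fun y => g y - f y) (Set.Ici 0) := by
    refine monotoneOn_of_hasDerivWithinAt_nonneg (f' := fun y => g' y - f' y) (convex_Ici 0)
      (fun y _ => ((hg y).sub (hf y)).continuousAt.continuousWithinAt)
      (fun y _ => ((hg y).sub (hf y)).hasDerivWithinAt) fun y hy => ?_
    rw [interior_Ici] at hy
    exact sub_nonneg.2 (h y (le_of_lt hy))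
  have := hmono Set.self_mem_Ici hx hx
  simp only [h0, sub_self] at this
  linarith

theorem sin_ge_cubic {x : ℝ} (hx : 0 ≤ x) : x - x ^ 3 / 6 ≤ sin x := by
  refine le_of_hasDerivAt_le (f := fun x => x - x ^ 3 / 6) (f' := fun x => 1 - x ^ 2 / 2)
    (fun x => ?_) hasDerivAt_sin (by simp) (fun x _ => one_sub_sq_div_two_le_cos) hx
  exact ((hasDerivAt_id x).sub ((hasDerivAt_pow 3 x).div_const 6)).congr_deriv (by norm_num; ring)

theorem cos_le_quartic {x : ℝ} (hx : 0 ≤ x) : cos x ≤ 1 - x ^ 2 / 2 + x ^ 4 / 24 := by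
  refine le_of_hasDerivAt_le (g := fun x => 1 - x ^ 2 / 2 + x ^ 4 / 24)
    (g' := fun x => -(x - x ^ 3 / 6)) hasDerivAt_cos (fun x => ?_) (by simp)
    (fun x hx => neg_le_neg (sin_ge_cubic hx)) hx
  exact ((((hasDerivAt_pow 2 x).div_const 2).const_sub 1).add
    ((hasDerivAt_pow 4 x).div_const 24)).congr_deriv (by norm_num; ring)

theorem sin_le_quintic {x : ℝ} (hx : 0 ≤ x) : sin x ≤ x - x ^ 3 / 6 + x ^ 5 / 120 := by
  refine le_of_hasDerivAt_le (g := fun x => x - x ^ 3 / 6 + x ^ 5 / 120)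
    (g' := fun x => 1 - x ^ 2 / 2 + x ^ 4 / 24) hasDerivAt_sin (fun x => ?_) (by simp)
    (fun x hx => cos_le_quartic hx) hx
  exact (((hasDerivAt_id x).sub ((hasDerivAt_pow 3 x).div_const 6)).add
    ((hasDerivAt_pow 5 x).div_const 120)).congr_deriv (by norm_num; ring)

theorem cos_ge_sextic {x : ℝ} (hx : 0 ≤ x) :
    1 - x ^ 2 / 2 + x ^ 4 / 24 - x ^ 6 / 720 ≤ cos x := by
  refine le_of_hasDerivAt_le (f := fun x => 1 - x ^ 2 / 2 + x ^ 4 / 24 - x ^ 6 / 720)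
    (f' := fun x => -(x - x ^ 3 / 6 + x ^ 5 / 120)) (fun x => ?_) hasDerivAt_cos (by simp)
    (fun x hx => neg_le_neg (sin_le_quintic hx)) hx
  exact (((((hasDerivAt_pow 2 x).div_const 2).const_sub 1).add
    ((hasDerivAt_pow 4 x).div_const 24)).sub
    ((hasDerivAt_pow 6 x).div_const 720)).congr_deriv (by norm_num; ring)

theorem sin_ge_septic {x : ℝ} (hx : 0 ≤ x) :
    x - x ^ 3 / 6 + x ^ 5 / 120 - x ^ 7 / 5040 ≤ sin x := by
  refine le_of_hasDerivAt_le (f := fun x => x - x ^ 3 / 6 + x ^ 5 / 120 - x ^ 7 / 5040)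
    (f' := fun x => 1 - x ^ 2 / 2 + x ^ 4 / 24 - x ^ 6 / 720) (fun x => ?_) hasDerivAt_sin
    (by simp) (fun x hx => cos_ge_sextic hx) hx
  exact ((((hasDerivAt_id x).sub ((hasDerivAt_pow 3 x).div_const 6)).add
    ((hasDerivAt_pow 5 x).div_const 120)).sub
    ((hasDerivAt_pow 7 x).div_const 5040)).congr_deriv (by norm_num; ring)

theorem cos_le_octic {x : ℝ} (hx : 0 ≤ x) :
    cos x ≤ 1 - x ^ 2 / 2 + x ^ 4 / 24 - x ^ 6 / 720 + x ^ 8 / 40320 := by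
  refine le_of_hasDerivAt_le
    (g := fun x => 1 - x ^ 2 / 2 + x ^ 4 / 24 - x ^ 6 / 720 + x ^ 8 / 40320)
    (g' := fun x => -(x - x ^ 3 / 6 + x ^ 5 / 120 - x ^ 7 / 5040)) hasDerivAt_cos
    (fun x => ?_) (by simp) (fun x hx => neg_le_neg (sin_ge_septic hx)) hx
  exact ((((((hasDerivAt_pow 2 x).div_const 2).const_sub 1).add
    ((hasDerivAt_pow 4 x).div_const 24)).sub ((hasDerivAt_pow 6 x).div_const 720)).add
    ((hasDerivAt_pow 8 x).div_const 40320)).congr_deriv (by norm_num; ring)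

/-! ### Half the side length of a regular polygon -/

/-- Half the side length of the regular spherical `n`-gon of area `x`. -/
noncomputable def halfSide (x n : ℝ) : ℝ :=
  arccos (cos (π / n) / cos (π / n - x / (2 * n)))

theorem base_angle_bounds {x n : ℝ} (hn : 2 < n) (hx : x ∈ Set.Ioo 0 (2 * π)) :
    0 < π / n - x / (2 * n) ∧ π / n - x / (2 * n) < π / n ∧ π / n < π / 2 := by
  have h1 : π / n - x / (2 * n) = (2 * π - x) / (2 * n) := by field_simp
  refine ⟨?_, ?_, by gcongr⟩
  · rw [h1]
    exact div_pos (sub_pos.2 hx.2) (by linarith)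
  · exact sub_lt_self _ (div_pos hx.1 (by linarith))

theorem cos_div_cos_mem_Ioo {φ ψ : ℝ} (hψ : 0 < ψ) (h : ψ < φ) (hφ : φ < π / 2) :
    cos φ / cos ψ ∈ Set.Ioo 0 1 := by
  have h1 : 0 < cos φ := cos_pos_of_mem_Ioo ⟨by linarith, hφ⟩
  have h2 : cos φ < cos ψ := cos_lt_cos_of_nonneg_of_le_pi_div_two hψ.le hφ.le h
  exact ⟨div_pos h1 (h1.trans h2), (div_lt_one (h1.trans h2)).2 h2⟩

theorem regPerim_eq_halfSide {x n : ℝ} (hn : 2 < n) (hx : x ∈ Set.Ioo 0 (2 * π)) :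
    regPerim x n = 2 * n * halfSide x n := by
  obtain ⟨h1, h2, h3⟩ := base_angle_bounds hn hx
  obtain ⟨hu0, hu1⟩ := cos_div_cos_mem_Ioo h1 h2 h3
  have hψ : (π - (2 * π - x) / n) / 2 = π / 2 - (π / n - x / (2 * n)) := by
    field_simp
  have hc : cos (π / n - x / (2 * n)) ≠ 0 :=
    (cos_pos_of_mem_Ioo ⟨by linarith, by linarith⟩).ne'
  have harg : (cos (2 * π / n) + cos ((π - (2 * π - x) / n) / 2) ^ 2) /
      sin ((π - (2 * π - x) / n) / 2) ^ 2 = cos (2 * halfSide x n) := by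
    rw [cos_two_mul, halfSide, cos_arccos (by linarith) hu1.le, hψ, cos_pi_div_two_sub,
      sin_pi_div_two_sub, mul_div_assoc, cos_two_mul, sin_sq]
    generalize cos (π / n - x / (2 * n)) = c at hc ⊢
    field_simp
    ring
  have hle : halfSide x n ≤ π / 2 := arccos_le_pi_div_two.2 hu0.le
  have hnonneg : 0 ≤ halfSide x n := arccos_nonneg _
  rw [regPerim, harg, arccos_cos (by linarith) (by linarith)]
  ring

theorem hasDerivAt_arccos_cos_div_cos {φ ψ : ℝ → ℝ} {φ' ψ' s : ℝ}
    (hφ : HasDerivAt φ φ' s) (hψ : HasDerivAt ψ ψ' s) (h0 : 0 < ψ s)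
    (h1 : ψ s < φ s) (h2 : φ s < π / 2) :
    HasDerivAt (fun r => arccos (cos (φ r) / cos (ψ r)))
      ((sin (φ s) * φ' * cos (ψ s) - cos (φ s) * sin (ψ s) * ψ') /
        (cos (ψ s) ^ 2 * √(1 - (cos (φ s) / cos (ψ s)) ^ 2))) s := by
  obtain ⟨hu0, hu1⟩ := cos_div_cos_mem_Ioo h0 h1 h2
  have hc : cos (ψ s) ≠ 0 := (cos_pos_of_mem_Ioo ⟨by linarith, by linarith⟩).ne'
  refine ((hasDerivAt_arccos (by linarith) hu1.ne).comp s (hφ.cos.div hψ.cos hc)).congr_deriv ?_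
  have hw : √(1 - (cos (φ s) / cos (ψ s)) ^ 2) ≠ 0 :=
    (sqrt_pos.2 (by nlinarith)).ne'
  field_simp
  ring

/-- The derivative of the perimeter with respect to the area. -/
theorem hasDerivAt_regPerim_area {x n : ℝ} (hn : 2 < n) (hx : x ∈ Set.Ioo 0 (2 * π)) :
    HasDerivAt (fun y => regPerim y n)
      (cos (π / n) * sin (π / n - x / (2 * n)) / (cos (π / n - x / (2 * n)) ^ 2 *
        √(1 - (cos (π / n) / cos (π / n - x / (2 * n))) ^ 2))) x := by
  obtain ⟨h1, h2, h3⟩ := base_angle_bounds hn hx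
  have key := (hasDerivAt_arccos_cos_div_cos (hasDerivAt_const x (π / n))
    (((hasDerivAt_id x).div_const (2 * n)).const_sub (π / n)) h1 h2 h3).const_mul (2 * n)
  refine (key.congr_of_eventuallyEq ?_).congr_deriv ?_
  · filter_upwards [Ioo_mem_nhds hx.1 hx.2] with y hy
    exact regPerim_eq_halfSide hn hy
  · simp only [id]
    have : n ≠ 0 := by linarith
    field_simp
    ring

/-- The derivative of the perimeter with respect to the number of sides. -/
theorem hasDerivAt_regPerim_sides {x n : ℝ} (hn : 2 < n) (hx : x ∈ Set.Ioo 0 (2 * π)) :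
    HasDerivAt (fun m => regPerim x m)
      (2 * halfSide x n + 2 * n *
        ((sin (π / n) * (-π / n ^ 2) * cos (π / n - x / (2 * n)) -
          cos (π / n) * sin (π / n - x / (2 * n)) * (-(π - x / 2) / n ^ 2)) /
        (cos (π / n - x / (2 * n)) ^ 2 *
          √(1 - (cos (π / n) / cos (π / n - x / (2 * n))) ^ 2)))) n := by
  obtain ⟨h1, h2, h3⟩ := base_angle_bounds hn hx
  have hn0 : n ≠ 0 := by linarith
  have hinv : ∀ c : ℝ, HasDerivAt (fun m : ℝ => c / m) (-c / n ^ 2) n := fun c =>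
    ((hasDerivAt_inv hn0).const_mul c).congr_deriv (by ring)
  have hψ : HasDerivAt (fun m : ℝ => π / m - x / (2 * m)) (-(π - x / 2) / n ^ 2) n := by
    refine (((hinv π).sub (hinv (x / 2))).congr_deriv (by ring)).congr_of_eventuallyEq ?_
    exact Filter.Eventually.of_forall fun m => by simp [div_div]
  have key := ((hasDerivAt_id n).const_mul 2).mul
    (hasDerivAt_arccos_cos_div_cos (hinv π) hψ h1 h2 h3)
  refine (key.congr_of_eventuallyEq ?_).congr_deriv ?_
  · filter_upwards [Ioi_mem_nhds hn] with m hm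
    exact regPerim_eq_halfSide hm hx
  · simp [halfSide]

theorem concaveOn_regPerim {n : ℝ} (hn : 2 < n) :
    ConcaveOn ℝ (Set.Ioo 0 (2 * π)) fun x => regPerim x n := by
  refine AntitoneOn.concaveOn_of_deriv (convex_Ioo _ _)
    (fun x hx => (hasDerivAt_regPerim_area hn hx).continuousAt.continuousWithinAt)
    (fun x hx => (hasDerivAt_regPerim_area hn
      (interior_subset hx)).differentiableAt.differentiableWithinAt) ?_
  rw [interior_Ioo]
  intro x hx y hy hxy
  rw [(hasDerivAt_regPerim_area hn hx).deriv, (hasDerivAt_regPerim_area hn hy).deriv]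
  obtain ⟨h1, h2, h3⟩ := base_angle_bounds hn hx
  obtain ⟨k1, k2, -⟩ := base_angle_bounds hn hy
  obtain ⟨hu0, hu1⟩ := cos_div_cos_mem_Ioo h1 h2 h3
  have hle : π / n - y / (2 * n) ≤ π / n - x / (2 * n) := by gcongr
  have hcos : cos (π / n - x / (2 * n)) ≤ cos (π / n - y / (2 * n)) :=
    cos_le_cos_of_nonneg_of_le_pi k1.le (by linarith) hle
  have hsin : sin (π / n - y / (2 * n)) ≤ sin (π / n - x / (2 * n)) :=
    sin_le_sin_of_le_of_le_pi_div_two (by linarith) (by linarith) hle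
  have hc0 : 0 < cos (π / n - x / (2 * n)) := cos_pos_of_mem_Ioo ⟨by linarith, by linarith⟩
  have hφ0 : 0 < cos (π / n) := cos_pos_of_mem_Ioo ⟨by linarith, h3⟩
  have hs0 : 0 ≤ sin (π / n - x / (2 * n)) :=
    sin_nonneg_of_nonneg_of_le_pi h1.le (by linarith)
  have hw0 : 0 < √(1 - (cos (π / n) / cos (π / n - x / (2 * n))) ^ 2) :=
    sqrt_pos.2 (by nlinarith)
  have hu0' : 0 ≤ cos (π / n) / cos (π / n - y / (2 * n)) :=
    div_nonneg hφ0.le (hc0.le.trans hcos)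
  gcongr

theorem ConcaveOn.add_affine_pos {s : Set ℝ} {f : ℝ → ℝ} (hf : ConcaveOn ℝ s f) {a b x m k : ℝ}
    (ha : a ∈ s) (hb : b ∈ s) (hx : x ∈ Set.Icc a b) (hfa : 0 < f a + m * a + k)
    (hfb : 0 < f b + m * b + k) : 0 < f x + m * x + k := by
  obtain ⟨α, β, hα, hβ, hαβ, rfl⟩ := Icc_subset_segment (𝕜 := ℝ) hx
  have h1 := hf.2 ha hb hα hβ hαβ
  have h2 := convex_Ioi (0 : ℝ) (Set.mem_Ioi.2 hfa) (Set.mem_Ioi.2 hfb) hα hβ hαβ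
  simp only [smul_eq_mul, Set.mem_Ioi] at h1 h2 ⊢
  have h3 : k = (α + β) * k := by rw [hαβ, one_mul]
  linarith

/-- A concave function of `ρ * π / 3 - t` plus an affine function of `(t, ρ)` is positive on a
rectangle as soon as it is positive at the four corners. -/
theorem ConcaveOn.pos_of_corners {s : Set ℝ} {f : ℝ → ℝ} (hf : ConcaveOn ℝ s f)
    {a b T D k p ρ t : ℝ} (hρ : ρ ∈ Set.Icc a b) (ht : t ∈ Set.Icc 0 T)
    (hs : Set.Icc (a * π / 3 - T) (b * π / 3) ⊆ s)
    (h1 : 0 < f (a * π / 3) + k - a * p)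
    (h2 : 0 < f (b * π / 3) + k - b * p)
    (h3 : 0 < f (a * π / 3 - T) + T * D + k - a * p)
    (h4 : 0 < f (b * π / 3 - T) + T * D + k - b * p) :
    0 < f (ρ * π / 3 - t) + t * D + k - ρ * p := by
  have hπ := pi_pos
  have hT : 0 ≤ T := ht.1.trans ht.2
  have hscale : ∀ {c d : ℝ}, c ≤ d → c * π / 3 ≤ d * π / 3 := fun h => by gcongr
  have haρ := hscale hρ.1
  have hρb := hscale hρ.2
  have conv : ∀ c : ℝ, 3 / π * (c * π / 3) = c := fun c => by field_simp
  have edge0 : 0 < f (ρ * π / 3) + k - ρ * p := by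
    have := hf.add_affine_pos (m := -(3 / π * p)) (k := k)
      (a := a * π / 3) (b := b * π / 3) (x := ρ * π / 3)
      (hs ⟨by linarith, by linarith⟩) (hs ⟨by linarith, le_rfl⟩) ⟨haρ, hρb⟩
      (by linear_combination h1 + p * conv a) (by linear_combination h2 + p * conv b)
    linear_combination this - p * conv ρ
  have edgeT : 0 < f (ρ * π / 3 - T) + T * D + k - ρ * p := by
    have := hf.add_affine_pos (m := -(3 / π * p)) (k := T * D + k - 3 / π * T * p)
      (a := a * π / 3 - T) (b := b * π / 3 - T) (x := ρ * π / 3 - T)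
      (hs ⟨le_rfl, by linarith⟩) (hs ⟨by linarith, by linarith⟩) ⟨by linarith, by linarith⟩
      (by linear_combination h3 + p * conv a) (by linear_combination h4 + p * conv b)
    linear_combination this - p * conv ρ
  have := hf.add_affine_pos (m := -D) (k := ρ * π / 3 * D + k - ρ * p)
    (a := ρ * π / 3 - T) (b := ρ * π / 3) (x := ρ * π / 3 - t)
    (hs ⟨by linarith, by linarith⟩) (hs ⟨by linarith, hρb⟩)
    ⟨by linarith [ht.2], by linarith [ht.1]⟩
    (by linear_combination edgeT) (by linear_combination edge0)
  linear_combination this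

/-! ### Numerical bounds -/

theorem le_regPerim {x n c ψ θ : ℝ} (hn : 2 < n) (hx : x ∈ Set.Ioo 0 (2 * π))
    (hc : cos (π / n) ≤ c) (hψ : π / n - x / (2 * n) ≤ ψ) (hψ1 : ψ ≤ 1)
    (hθ : 0 ≤ θ) (hθ1 : θ ≤ 1)
    (h : c ≤ (1 - θ ^ 2 / 2 + θ ^ 4 / 24 - θ ^ 6 / 720) *
      (1 - ψ ^ 2 / 2 + ψ ^ 4 / 24 - ψ ^ 6 / 720)) :
    2 * n * θ ≤ regPerim x n := by
  obtain ⟨h1, h2, h3⟩ := base_angle_bounds hn hx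
  have hπ := pi_gt_three
  have hψ0 : 0 ≤ ψ := h1.le.trans hψ
  have hcψ : cos ψ ≤ cos (π / n - x / (2 * n)) :=
    cos_le_cos_of_nonneg_of_le_pi h1.le (by linarith) hψ
  have hψpos : 0 < cos ψ := cos_pos_of_mem_Ioo ⟨by linarith, by linarith⟩
  have hθpos : 0 < cos θ := cos_pos_of_mem_Ioo ⟨by linarith, by linarith⟩
  have hpoly : 0 ≤ 1 - ψ ^ 2 / 2 + ψ ^ 4 / 24 - ψ ^ 6 / 720 := by
    nlinarith [pow_le_one₀ hψ0 hψ1 (n := 2), pow_le_one₀ hψ0 hψ1 (n := 6), pow_nonneg hψ0 4]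
  rw [regPerim_eq_halfSide hn hx]
  have : θ ≤ halfSide x n := by
    rw [← arccos_cos hθ (by linarith), halfSide]
    refine arccos_le_arccos ((div_le_iff₀ (hψpos.trans_le hcψ)).2 ?_)
    calc cos (π / n) ≤ _ := hc.trans h
      _ ≤ cos θ * cos ψ :=
        mul_le_mul (cos_ge_sextic hθ) (cos_ge_sextic hψ0) hpoly hθpos.le
      _ ≤ _ := by gcongr
  gcongr

theorem sqrt_five_mem_Icc : √5 ∈ Set.Icc 2.236067 2.236068 :=
  ⟨le_sqrt_of_sq_le (by norm_num), sqrt_le_iff.2 ⟨by norm_num, by norm_num⟩⟩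

theorem cos_pi_div_five_le : cos (π / 5) ≤ 0.809017 := by
  rw [cos_pi_div_five]
  linarith [sqrt_five_mem_Icc.2]

theorem sin_pi_div_five_ge : 0.5877 ≤ sin (π / 5) := by
  have h := pi_gt_d4
  have h' := pi_lt_d4
  refine le_trans ?_ (sin_le_sin_of_le_of_le_pi_div_two (x := 0.6283) ?_ ?_ ?_)
  · exact le_trans (by norm_num) (sin_ge_septic (by norm_num))
  all_goals linarith

theorem p5_le_s13 : p5 ≤ 3.64865 := by
  have hz : (4 * cos (2 * π / 5) + 1) / 3 = √5 / 3 := by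
    rw [mul_div_assoc, cos_two_mul, cos_pi_div_five]
    linear_combination (1 / 6 : ℝ) * sq_sqrt (show (0 : ℝ) ≤ 5 by norm_num)
  have hcos : cos 0.72973 ≤ √5 / 3 :=
    (cos_le_octic (by norm_num)).trans (by linarith [sqrt_five_mem_Icc.1])
  have := arccos_le_arccos hcos
  rw [arccos_cos (by norm_num) (by linarith [pi_gt_three])] at this
  rw [p5, hz]
  linarith

theorem p5_eq_regPerim : p5 = regPerim (π / 3) 5 := by
  rw [p5, regPerim, show (π - (2 * π - π / 3) / 5) / 2 = π / 3 by ring, cos_pi_div_three,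
    sin_pi_div_three, div_pow √3, sq_sqrt (by norm_num)]
  ring_nf

theorem pi_div_three_mem_Ioo : π / 3 ∈ Set.Ioo 0 (2 * π) :=
  ⟨by linarith [pi_pos], by linarith [pi_pos]⟩

theorem sqrt_one_sub_ratio_mem_Ioc :
    √(1 - (cos (π / 5) / cos (π / 6)) ^ 2) ∈ Set.Ioc 0 0.35684 := by
  have h5 := sqrt_five_mem_Icc
  have h : 1 - (cos (π / 5) / cos (π / 6)) ^ 2 = (3 - √5) / 6 := by
    rw [div_pow, sq_cos_pi_div_six, cos_pi_div_five]
    linear_combination (-1 / 12 : ℝ) * sq_sqrt (show (0 : ℝ) ≤ 5 by norm_num)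
  rw [h]
  refine ⟨sqrt_pos.2 (by linarith [h5.2]), sqrt_le_iff.2 ⟨by norm_num, ?_⟩⟩
  norm_num at h5 ⊢
  linarith [h5.1]

theorem neg_B'_ge : 1.511 ≤ -B' := by
  obtain ⟨hw0, hw⟩ := sqrt_one_sub_ratio_mem_Ioc
  have h := (hasDerivAt_regPerim_area (n := 5) (by norm_num) pi_div_three_mem_Ioo).deriv
  rw [B', neg_neg, h, show π / 5 - π / 3 / (2 * 5) = π / 6 by ring, sq_cos_pi_div_six,
    sin_pi_div_six, le_div_iff₀ (by positivity)]
  have := sqrt_five_mem_Icc.1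
  have hc := cos_pi_div_five
  norm_num at *
  linarith

theorem p5'_le : p5' ≤ -0.07 := by
  obtain ⟨hw0, hw⟩ := sqrt_one_sub_ratio_mem_Ioc
  have hp := p5_le_s13
  have h := (hasDerivAt_regPerim_sides (n := 5) (by norm_num) pi_div_three_mem_Ioo).deriv
  rw [p5_eq_regPerim, regPerim_eq_halfSide (by norm_num) pi_div_three_mem_Ioo] at hp
  rw [p5', h, show π / 5 - π / 3 / (2 * 5) = π / 6 by ring, sq_cos_pi_div_six, sin_pi_div_six]
  generalize √(1 - (cos (π / 5) / cos (π / 6)) ^ 2) = w at *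
  have hc6 : 0.866 ≤ cos (π / 6) := by
    rw [cos_pi_div_six]
    have : 1.732 ≤ √3 := le_sqrt_of_sq_le (by norm_num)
    linarith
  have hc5 := cos_pi_div_five_le
  have hsc : 0.5877 * 0.866 ≤ sin (π / 5) * cos (π / 6) :=
    mul_le_mul sin_pi_div_five_ge hc6 (by norm_num) ((by norm_num : (0:ℝ) ≤ 0.5877).trans
      sin_pi_div_five_ge)
  have hnum : 0.0215 ≤ π * (sin (π / 5) * cos (π / 6) / 25 - cos (π / 5) / 60) := by
    have : 3.1415 * 0.00687 ≤ π * (sin (π / 5) * cos (π / 6) / 25 - cos (π / 5) / 60) :=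
      mul_le_mul pi_gt_d4.le (by linarith) (by norm_num) pi_pos.le
    linarith
  have hq : 0.080 ≤ π * (sin (π / 5) * cos (π / 6) / 25 - cos (π / 5) / 60) / (3 / 4 * w) := by
    rw [le_div_iff₀ (by positivity)]
    linarith
  have heq : (sin (π / 5) * (-π / 5 ^ 2) * cos (π / 6) -
      cos (π / 5) * (1 / 2) * (-(π - π / 3 / 2) / 5 ^ 2)) / (3 / 4 * w) =
      -(π * (sin (π / 5) * cos (π / 6) / 25 - cos (π / 5) / 60) / (3 / 4 * w)) := by
    ring
  rw [heq]
  linarith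

theorem cos_pi_div_six_le : cos (π / 6) ≤ 0.866026 := by
  rw [cos_pi_div_six]
  have : √3 ≤ 1.732051 := sqrt_le_iff.2 ⟨by norm_num, by norm_num⟩
  linarith

theorem cos_pi_div_seven_le : cos (π / 7) ≤ 0.9011 := by
  have h := pi_gt_d4
  exact (cos_le_cos_of_nonneg_of_le_pi (x := 0.4487) (by norm_num) (by linarith)
    (by linarith)).trans ((cos_le_octic (by norm_num)).trans (by norm_num))

theorem case_T_small_pos :
    ∀ n ∈ ({5, 6, 7} : Set ℕ), ∀ ρ ∈ Set.Icc (rho1 n) (Rbd n),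
      ∀ t ∈ Set.Icc (0 : ℝ) (T1 n),
        Ifun (regPerim (ρ * π / 3 - t) (n : ℝ)) (n : ℝ) t ρ > 0 := by
  intro n hn ρ hρ t ht
  have hπ := pi_gt_d6
  have hπ' := pi_lt_d6
  have hp := p5_le_s13
  have hB := neg_B'_ge
  have hq := p5'_le
  suffices 0 < regPerim (ρ * π / 3 - t) n + t * -B' + (5 - n) * p5' - ρ * p5 by
    rw [Ifun]
    linarith
  rcases hn with rfl | rfl | rfl
  · simp only [rho1, T1, Rbd] at hρ ht
    norm_num only [Nat.cast_ofNat] at hρ ht ⊢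
    refine (concaveOn_regPerim (n := 5) (by norm_num)).pos_of_corners hρ ht
      (fun x hx => ⟨by linarith [hx.1], by linarith [hx.2]⟩) ?_ ?_ ?_ ?_
    · have := le_regPerim (x := 0.913 * π / 3) (n := 5) (ψ := 0.532711) (θ := 0.35064)
        (by norm_num) ⟨by linarith, by linarith⟩ cos_pi_div_five_le (by linarith) (by norm_num)
        (by norm_num) (by norm_num) (by norm_num)
      linarith
    · have := le_regPerim (x := 0.9957 * π / 3) (n := 5) (ψ := 0.524051) (θ := 0.36417)
        (by norm_num) ⟨by linarith, by linarith⟩ cos_pi_div_five_le (by linarith) (by norm_num)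
        (by norm_num) (by norm_num) (by norm_num)
      linarith
    · have := le_regPerim (x := 0.913 * π / 3 - 0.117) (n := 5) (ψ := 0.544411) (θ := 0.33092)
        (by norm_num) ⟨by linarith, by linarith⟩ cos_pi_div_five_le (by linarith) (by norm_num)
        (by norm_num) (by norm_num) (by norm_num)
      linarith
    · have := le_regPerim (x := 0.9957 * π / 3 - 0.117) (n := 5) (ψ := 0.535751) (θ := 0.34568)
        (by norm_num) ⟨by linarith, by linarith⟩ cos_pi_div_five_le (by linarith) (by norm_num)
        (by norm_num) (by norm_num) (by norm_num)
      linarith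
  · simp only [rho1, T1, Rbd] at hρ ht
    norm_num only [Nat.cast_ofNat] at hρ ht ⊢
    refine (concaveOn_regPerim (n := 6) (by norm_num)).pos_of_corners hρ ht
      (fun x hx => ⟨by linarith [hx.1], by linarith [hx.2]⟩) ?_ ?_ ?_ ?_
    · have := le_regPerim (x := 0.952 * π / 3) (n := 6) (ψ := 0.440523) (θ := 0.29273)
        (by norm_num) ⟨by linarith, by linarith⟩ cos_pi_div_six_le (by linarith) (by norm_num)
        (by norm_num) (by norm_num) (by norm_num)
      linarith
    · have := le_regPerim (x := 1 * π / 3) (n := 6) (ψ := 0.436334) (θ := 0.29917)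
        (by norm_num) ⟨by linarith, by linarith⟩ cos_pi_div_six_le (by linarith) (by norm_num)
        (by norm_num) (by norm_num) (by norm_num)
      linarith
    · have := le_regPerim (x := 0.952 * π / 3 - 0.065) (n := 6) (ψ := 0.445939) (θ := 0.28406)
        (by norm_num) ⟨by linarith, by linarith⟩ cos_pi_div_six_le (by linarith) (by norm_num)
        (by norm_num) (by norm_num) (by norm_num)
      linarith
    · have := le_regPerim (x := 1 * π / 3 - 0.065) (n := 6) (ψ := 0.44175) (θ := 0.2908)
        (by norm_num) ⟨by linarith, by linarith⟩ cos_pi_div_six_le (by linarith) (by norm_num)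
        (by norm_num) (by norm_num) (by norm_num)
      linarith
  · simp only [rho1, T1, Rbd] at hρ ht
    norm_num only [Nat.cast_ofNat] at hρ ht ⊢
    refine (concaveOn_regPerim (n := 7) (by norm_num)).pos_of_corners hρ ht
      (fun x hx => ⟨by linarith [hx.1], by linarith [hx.2]⟩) ?_ ?_ ?_ ?_
    · have := le_regPerim (x := 0.99 * π / 3) (n := 7) (ψ := 0.374749) (θ := 0.25203)
        (by norm_num) ⟨by linarith, by linarith⟩ cos_pi_div_seven_le (by linarith) (by norm_num)
        (by norm_num) (by norm_num) (by norm_num)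
      linarith
    · have := le_regPerim (x := 1 * π / 3) (n := 7) (ψ := 0.374001) (θ := 0.25316)
        (by norm_num) ⟨by linarith, by linarith⟩ cos_pi_div_seven_le (by linarith) (by norm_num)
        (by norm_num) (by norm_num) (by norm_num)
      linarith
    · have := le_regPerim (x := 0.99 * π / 3 - 0.0134) (n := 7) (ψ := 0.375706) (θ := 0.25057)
        (by norm_num) ⟨by linarith, by linarith⟩ cos_pi_div_seven_le (by linarith) (by norm_num)
        (by norm_num) (by norm_num) (by norm_num)
      linarith
    · have := le_regPerim (x := 1 * π / 3 - 0.0134) (n := 7) (ψ := 0.374958) (θ := 0.25171)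
        (by norm_num) ⟨by linarith, by linarith⟩ cos_pi_div_seven_le (by linarith) (by norm_num)
        (by norm_num) (by norm_num) (by norm_num)
      linarith
end
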